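/- arXiv:2604.09582 — 16 statements merged into one kernel-verified Lean document; each statement's English description precedes it below -/
import Mathlib

section
/- Let (A, B, R) be a normalized formal context. If (X, Y) ∈ C_N, then the complemented pair also belongs to C_N, that is, ((B \ X)^{↑N} = A \ Y and (A \ Y)^{↓N} = B \ X. -/
/-- Necessity operator sending a set of objects to a set of attributes:
`X^{↑N} = {a | ∀ b, (a,b) ∈ R → b ∈ X}`. -/
def upN {α β : Type*} (R : α → β → Prop) (X : Set β) : Set α :=
  {a | ∀ b, R a b → b ∈ X}

/-- Necessity operator sending a set of attributes to a set of objects: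
`Y^{↓N} = {b | ∀ a, (a,b) ∈ R → a ∈ Y}`. -/
def downN {α β : Type*} (R : α → β → Prop) (Y : Set α) : Set β :=
  {b | ∀ a, R a b → a ∈ Y}

/-- A context is normalized if every attribute is related to some object and fails to be
related to some object, and dually for objects. -/
def Normalized {α β : Type*} (R : α → β → Prop) : Prop :=
  (∀ a, ∃ b, R a b) ∧ (∀ a, ∃ b, ¬ R a b) ∧ (∀ b, ∃ a, R a b) ∧ (∀ b, ∃ a, ¬ R a b)

/-- For a pair in `C_N`, related attributes and objects lie in the pair simultaneously. -/
theorem mem_iff_mem_of_upN_eq_of_downN_eq {α β : Type*} {R : α → β → Prop} {X : Set β} {Y : Set α}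
    (h1 : upN R X = Y) (h2 : downN R Y = X) {a : α} {b : β} (hab : R a b) : a ∈ Y ↔ b ∈ X :=
  ⟨fun ha => (h1.symm ▸ ha : a ∈ upN R X) b hab, fun hb => (h2.symm ▸ hb : b ∈ downN R Y) a hab⟩

/-- If `(X, Y) ∈ C_N` in a normalized context then the complemented pair also belongs
to `C_N`. -/
theorem complement_mem_CN {α β : Type*} (R : α → β → Prop) (hN : Normalized R)
    (X : Set β) (Y : Set α) (h1 : upN R X = Y) (h2 : downN R Y = X) :
    upN R Xᶜ = Yᶜ ∧ downN R Yᶜ = Xᶜ := by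
  have key : ∀ {a b}, R a b → (a ∈ Y ↔ b ∈ X) := mem_iff_mem_of_upN_eq_of_downN_eq h1 h2
  obtain ⟨hA, -, hB, -⟩ := hN
  constructor
  · ext a
    refine ⟨fun h ha => ?_, fun ha b hab hb => ha ((key hab).2 hb)⟩
    obtain ⟨b, hab⟩ := hA a
    exact h b hab ((key hab).1 ha)
  · ext b
    refine ⟨fun h hb => ?_, fun hb a hab ha => hb ((key hab).1 ha)⟩
    obtain ⟨a, hab⟩ := hB b
    exact h a hab ((key hab).2 hb)
end

section
/- Let (A, B, R) be a normalized formal context and let (X, Y), (X*, Y*) ∈ C_N with X ⊆ X* (hence Y ⊆ Y*). Then the set-difference pair also belongs to C_N, that is, (X* \ X)^{↑N} = Y* \ Y and (Y* \ Y)^{↓N} = X* \ X. -/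
/-- If `(X, Y)` and `(X*, Y*)` belong to `C_N` in a normalized context and `X ⊆ X*`,
then the set-difference pair `(X* \ X, Y* \ Y)` also belongs to `C_N`. -/
theorem diff_mem_CN {α β : Type*} (R : α → β → Prop) (hN : Normalized R)
    (X Xs : Set β) (Y Ys : Set α)
    (h1 : upN R X = Y) (h2 : downN R Y = X)
    (h3 : upN R Xs = Ys) (h4 : downN R Ys = Xs)
    (hsub : X ⊆ Xs) :
    upN R (Xs \ X) = Ys \ Y ∧ downN R (Ys \ Y) = Xs \ X := by
  have hXY : ∀ {a b}, R a b → (a ∈ Y ↔ b ∈ X) := fun {a b} h =>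
    ⟨fun ha => (h1.symm ▸ ha : a ∈ upN R X) b h, fun hb => (h2.symm ▸ hb : b ∈ downN R Y) a h⟩
  have hXYs : ∀ {a b}, R a b → (a ∈ Ys ↔ b ∈ Xs) := fun {a b} h =>
    ⟨fun ha => (h3.symm ▸ ha : a ∈ upN R Xs) b h, fun hb => (h4.symm ▸ hb : b ∈ downN R Ys) a h⟩
  obtain ⟨hA, -, hB, -⟩ := hN
  constructor
  · ext a
    refine ⟨fun ha => ?_, fun ha b h => ⟨(hXYs h).1 ha.1, fun hb => ha.2 ((hXY h).2 hb)⟩⟩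
    obtain ⟨b, h⟩ := hA a
    exact ⟨(hXYs h).2 (ha b h).1, fun hY => (ha b h).2 ((hXY h).1 hY)⟩
  · ext b
    refine ⟨fun hb => ?_, fun hb a h => ⟨(hXYs h).2 hb.1, fun ha => hb.2 ((hXY h).1 ha)⟩⟩
    obtain ⟨a, h⟩ := hB b
    exact ⟨(hXYs h).1 (hb a h).1, fun hX => (hb a h).2 ((hXY h).2 hX)⟩
end

section
/- Let (A, B, R) be a normalized formal context and let (X*, Y*) ∈ C_N be a join-irreducible element of the lattice (C_N, ≤), i.e. (X*, Y*) ≠ (∅, ∅) and whenever X* = X₁ ∪ X₂ and Y* = Y₁ ∪ Y₂ with (X₁,Y₁), (X₂,Y₂) ∈ C_N, then (X*,Y*) = (X₁,Y₁) or (X*,Y*) = (X₂,Y₂). Then (X*, Y*) is an atom of (C_N, ≤): there is no (X, Y) ∈ C_N with (∅, ∅) ≠ (X, Y) and X ⊊ X*. -/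
/-- In a context where every attribute and every object is related to something, the fixed pairs
of the necessity operators are closed under differences. -/
theorem upN_downN_sdiff {α β : Type*} {R : α → β → Prop}
    (hα : ∀ a, ∃ b, R a b) (hβ : ∀ b, ∃ a, R a b) {X₁ X₂ : Set β} {Y₁ Y₂ : Set α}
    (hu₁ : upN R X₁ = Y₁) (hd₁ : downN R Y₁ = X₁) (hu₂ : upN R X₂ = Y₂) (hd₂ : downN R Y₂ = X₂) :
    upN R (X₁ \ X₂) = Y₁ \ Y₂ ∧ downN R (Y₁ \ Y₂) = X₁ \ X₂ := by
  have up {X : Set β} {Y : Set α} (h : upN R X = Y) (a : α) :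
      a ∈ Y ↔ ∀ b, R a b → b ∈ X := by rw [← h]; rfl
  have down {X : Set β} {Y : Set α} (h : downN R Y = X) (b : β) :
      b ∈ X ↔ ∀ a, R a b → a ∈ Y := by rw [← h]; rfl
  constructor
  · ext a
    constructor
    · intro h
      obtain ⟨b, hb⟩ := hα a
      exact ⟨(up hu₁ a).2 fun b hb => (h b hb).1, fun ha => (h b hb).2 ((up hu₂ a).1 ha b hb)⟩
    · rintro ⟨h₁, h₂⟩ b hb
      exact ⟨(up hu₁ a).1 h₁ b hb, fun hX => h₂ ((down hd₂ b).1 hX a hb)⟩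
  · ext b
    constructor
    · intro h
      obtain ⟨a, ha⟩ := hβ b
      exact ⟨(down hd₁ b).2 fun a ha => (h a ha).1, fun hb => (h a ha).2 ((down hd₂ b).1 hb a ha)⟩
    · rintro ⟨h₁, h₂⟩ a ha
      exact ⟨(down hd₁ b).1 h₁ a ha, fun hY => h₂ ((up hu₂ a).1 hY b ha)⟩

/-- In a normalized context, every join-irreducible element of `(C_N, ≤)` is an atom:
there is no nontrivial element of `C_N` strictly below it. -/
theorem joinIrreducible_isAtom {α β : Type*} (R : α → β → Prop) (hN : Normalized R)
    (Xs : Set β) (Ys : Set α)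
    (hmem : upN R Xs = Ys ∧ downN R Ys = Xs)
    (hbot : ¬ (Xs = ∅ ∧ Ys = ∅))
    (hirr : ∀ X₁ X₂ : Set β, ∀ Y₁ Y₂ : Set α,
      upN R X₁ = Y₁ → downN R Y₁ = X₁ → upN R X₂ = Y₂ → downN R Y₂ = X₂ →
      Xs = X₁ ∪ X₂ → Ys = Y₁ ∪ Y₂ →
      (Xs = X₁ ∧ Ys = Y₁) ∨ (Xs = X₂ ∧ Ys = Y₂)) :
    ¬ ∃ (X : Set β) (Y : Set α), upN R X = Y ∧ downN R Y = X ∧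
      ¬ (X = ∅ ∧ Y = ∅) ∧ X ⊂ Xs := by
  rintro ⟨X, Y, hu, hd, hne, hss⟩
  obtain ⟨hα, -, hβ, -⟩ := hN
  obtain ⟨hus, hds⟩ := hmem
  obtain ⟨hu', hd'⟩ := upN_downN_sdiff hα hβ hus hds hu hd
  have hYs : Y ⊆ Ys := by
    rw [← hu, ← hus]
    exact fun a ha b hb => hss.1 (ha b hb)
  rcases hirr X (Xs \ X) Y (Ys \ Y) hu hd hu' hd' (Set.union_sdiff_cancel hss.1).symm
    (Set.union_sdiff_cancel hYs).symm with ⟨h, -⟩ | ⟨hX, hY⟩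
  · exact hss.ne h.symm
  · refine hne ⟨Set.eq_empty_of_forall_notMem fun b hb => ?_,
      Set.eq_empty_of_forall_notMem fun a ha => ?_⟩
    · exact (hX ▸ hss.1 hb : b ∈ Xs \ X).2 hb
    · exact (hY ▸ hYs ha : a ∈ Ys \ Y).2 ha
end

section
/- Let (A, B, R) be a normalized formal context with A and B finite. Then the family of join-irreducible elements of (C_N, ≤) determines a partition of B and of A: the union of the object components X* of all join-irreducible elements of C_N equals B, and the object components of two distinct join-irreducible elements are disjoint; and similarly the union of the attribute components Y* equals A and the attribute components of two distinct join-irreducible elements are disjoint. -/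
/-- The set `C_N` of pairs closed under the necessity operators. -/
def CN {α β : Type*} (R : α → β → Prop) : Set (Set β × Set α) :=
  {p | upN R p.1 = p.2 ∧ downN R p.2 = p.1}

/-- Join-irreducible elements of `(C_N, ≤)`: nontrivial pairs that cannot be written
as the union (supremum) of two strictly smaller elements of `C_N`. -/
def JoinIrr {α β : Type*} (R : α → β → Prop) : Set (Set β × Set α) :=
  {p | p ∈ CN R ∧ p ≠ (∅, ∅) ∧
    ∀ q r, q ∈ CN R → r ∈ CN R → p.1 = q.1 ∪ r.1 → p.2 = q.2 ∪ r.2 → p = q ∨ p = r}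

theorem mem_CN_iff {α β : Type*} {R : α → β → Prop} (hN : Normalized R)
    {p : Set β × Set α} : p ∈ CN R ↔ ∀ a b, R a b → (a ∈ p.2 ↔ b ∈ p.1) := by
  obtain ⟨hA, -, hB, -⟩ := hN
  constructor
  · rintro ⟨h₁, h₂⟩ a b hab
    refine ⟨fun ha => ?_, fun hb => ?_⟩
    · rw [← h₁] at ha
      exact ha b hab
    · rw [← h₂] at hb
      exact hb a hab
  · intro h
    refine ⟨Set.ext fun a => ⟨fun ha => ?_, fun ha b hab => (h a b hab).1 ha⟩,
      Set.ext fun b => ⟨fun hb => ?_, fun hb a hab => (h a b hab).2 hb⟩⟩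
    · obtain ⟨b, hab⟩ := hA a
      exact (h a b hab).2 (ha b hab)
    · obtain ⟨a, hab⟩ := hB b
      exact (h a b hab).1 (hb a hab)

theorem inter_mem_CN {α β : Type*} {R : α → β → Prop} (hN : Normalized R)
    {p q : Set β × Set α} (hp : p ∈ CN R) (hq : q ∈ CN R) :
    (p.1 ∩ q.1, p.2 ∩ q.2) ∈ CN R := by
  rw [mem_CN_iff hN] at *
  exact fun a b hab => and_congr (hp a b hab) (hq a b hab)

theorem diff_mem_CN_s3 {α β : Type*} {R : α → β → Prop} (hN : Normalized R)
    {p q : Set β × Set α} (hp : p ∈ CN R) (hq : q ∈ CN R) :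
    (p.1 \ q.1, p.2 \ q.2) ∈ CN R := by
  rw [mem_CN_iff hN] at *
  exact fun a b hab => and_congr (hp a b hab) (not_congr (hq a b hab))

/-- A join-irreducible element lies below any given element of `C_N` or is disjoint from it. -/
theorem JoinIrr.subset_or_disjoint {α β : Type*} {R : α → β → Prop} (hN : Normalized R)
    {p q : Set β × Set α} (hp : p ∈ JoinIrr R) (hq : q ∈ CN R) :
    (p.1 ⊆ q.1 ∧ p.2 ⊆ q.2) ∨ (Disjoint p.1 q.1 ∧ Disjoint p.2 q.2) := by
  obtain ⟨hpC, -, hirr⟩ := hp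
  rcases hirr _ _ (inter_mem_CN hN hpC hq) (diff_mem_CN_s3 hN hpC hq)
    (Set.inter_union_sdiff _ _).symm (Set.inter_union_sdiff _ _).symm with h | h
  · left
    exact ⟨Set.inter_eq_left.1 (congrArg Prod.fst h).symm,
      Set.inter_eq_left.1 (congrArg Prod.snd h).symm⟩
  · right
    exact ⟨sdiff_eq_left.1 (congrArg Prod.fst h).symm,
      sdiff_eq_left.1 (congrArg Prod.snd h).symm⟩

theorem JoinIrr.disjoint_of_ne {α β : Type*} {R : α → β → Prop} (hN : Normalized R)
    {p q : Set β × Set α} (hp : p ∈ JoinIrr R) (hq : q ∈ JoinIrr R) (hne : p ≠ q) :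
    Disjoint p.1 q.1 ∧ Disjoint p.2 q.2 := by
  rcases JoinIrr.subset_or_disjoint hN hp hq.1 with h | h
  · rcases JoinIrr.subset_or_disjoint hN hq hp.1 with h' | h'
    · exact absurd (Prod.ext (h.1.antisymm h'.1) (h.2.antisymm h'.2)) hne
    · exact ⟨h'.1.symm, h'.2.symm⟩
  · exact h

/-- Every object belongs to a join-irreducible element, namely the least element of `C_N`
containing it. -/
theorem exists_mem_joinIrr {α β : Type*} {R : α → β → Prop} (hN : Normalized R) (b : β) :
    ∃ p ∈ JoinIrr R, b ∈ p.1 := by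
  let p : Set β × Set α :=
    ({b' | ∀ q ∈ CN R, b ∈ q.1 → b' ∈ q.1}, {a | ∀ q ∈ CN R, b ∈ q.1 → a ∈ q.2})
  have hb : b ∈ p.1 := fun _ _ h => h
  have hle : ∀ q ∈ CN R, b ∈ q.1 → p.1 ⊆ q.1 ∧ p.2 ⊆ q.2 := fun q hq hbq =>
    ⟨fun _ h => h q hq hbq, fun _ h => h q hq hbq⟩
  have hp : p ∈ CN R := (mem_CN_iff hN).2 fun a b' hab =>
    forall_congr' fun q => forall_congr' fun hq => imp_congr_right fun _ =>
      (mem_CN_iff hN).1 hq a b' hab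
  refine ⟨p, ⟨hp, fun h => ?_, fun q r hq hr h₁ h₂ => ?_⟩, hb⟩
  · rw [h] at hb
    exact hb
  · have hbqr := hb
    rw [h₁] at hbqr
    rcases hbqr with hbq | hbr
    · left
      obtain ⟨h₁', h₂'⟩ := hle q hq hbq
      exact Prod.ext (h₁'.antisymm (h₁ ▸ Set.subset_union_left))
        (h₂'.antisymm (h₂ ▸ Set.subset_union_left))
    · right
      obtain ⟨h₁', h₂'⟩ := hle r hr hbr
      exact Prod.ext (h₁'.antisymm (h₁ ▸ Set.subset_union_right))
        (h₂'.antisymm (h₂ ▸ Set.subset_union_right))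

/-- In a finite normalized context, the join-irreducible elements of `C_N` determine
a partition of the set of objects and a partition of the set of attributes. -/
theorem joinIrr_partition {α β : Type*} [Finite α] [Finite β]
    (R : α → β → Prop) (hN : Normalized R) :
    (⋃ p ∈ JoinIrr R, p.1) = Set.univ ∧
    (∀ p ∈ JoinIrr R, ∀ q ∈ JoinIrr R, p ≠ q → Disjoint p.1 q.1) ∧
    (⋃ p ∈ JoinIrr R, p.2) = Set.univ ∧
    (∀ p ∈ JoinIrr R, ∀ q ∈ JoinIrr R, p ≠ q → Disjoint p.2 q.2) := by
  refine ⟨Set.eq_univ_of_forall fun b => ?_,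
    fun p hp q hq hne => (JoinIrr.disjoint_of_ne hN hp hq hne).1,
    Set.eq_univ_of_forall fun a => ?_,
    fun p hp q hq hne => (JoinIrr.disjoint_of_ne hN hp hq hne).2⟩
  · obtain ⟨p, hp, hb⟩ := exists_mem_joinIrr hN b
    exact Set.mem_biUnion hp hb
  · obtain ⟨b, hab⟩ := hN.1 a
    obtain ⟨p, hp, hb⟩ := exists_mem_joinIrr hN b
    exact Set.mem_biUnion hp (((mem_CN_iff hN).1 hp.1 a b hab).2 hb)
end

section
/- Let (A, B, R) be a formal context and (X₁, Y₁), (X₂, Y₂) ∈ C_N. Then (X₁ ∩ X₂, Y₁ ∩ Y₂) ∈ C_N; and if moreover the context is normalized, then also (X₁ ∪ X₂, Y₁ ∪ Y₂) ∈ C_N. -/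
theorem upN_inter {α β : Type*} (R : α → β → Prop) (X₁ X₂ : Set β) :
    upN R (X₁ ∩ X₂) = upN R X₁ ∩ upN R X₂ := by
  ext a
  simp only [upN, Set.mem_inter_iff, Set.mem_ofPred_eq]
  exact ⟨fun h => ⟨fun b hb => (h b hb).1, fun b hb => (h b hb).2⟩,
    fun h b hb => ⟨h.1 b hb, h.2 b hb⟩⟩

theorem downN_inter {α β : Type*} (R : α → β → Prop) (Y₁ Y₂ : Set α) :
    downN R (Y₁ ∩ Y₂) = downN R Y₁ ∩ downN R Y₂ :=
  upN_inter (fun b a => R a b) Y₁ Y₂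

/-- If every attribute is related to some object, then `upN` maps the union of the extents
of two pairs in `C_N` to the union of their intents. -/
theorem upN_union_eq {α β : Type*} {R : α → β → Prop} (hR : ∀ a, ∃ b, R a b)
    {X₁ X₂ : Set β} {Y₁ Y₂ : Set α} (u₁ : upN R X₁ = Y₁) (d₁ : downN R Y₁ = X₁)
    (u₂ : upN R X₂ = Y₂) (d₂ : downN R Y₂ = X₂) : upN R (X₁ ∪ X₂) = Y₁ ∪ Y₂ := by
  ext a
  constructor
  · intro ha
    obtain ⟨b, hb⟩ := hR a
    rcases ha b hb with h | h
    · rw [← d₁] at h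
      exact Or.inl (h a hb)
    · rw [← d₂] at h
      exact Or.inr (h a hb)
  · rintro (h | h) b hb
    · rw [← u₁] at h
      exact Or.inl (h b hb)
    · rw [← u₂] at h
      exact Or.inr (h b hb)

/-- `C_N` is closed under componentwise intersections; if moreover the context is
normalized, it is also closed under componentwise unions. -/
theorem inter_union_mem_CN {α β : Type*} (R : α → β → Prop)
    (X₁ X₂ : Set β) (Y₁ Y₂ : Set α)
    (h1 : upN R X₁ = Y₁ ∧ downN R Y₁ = X₁)
    (h2 : upN R X₂ = Y₂ ∧ downN R Y₂ = X₂) :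
    (upN R (X₁ ∩ X₂) = Y₁ ∩ Y₂ ∧ downN R (Y₁ ∩ Y₂) = X₁ ∩ X₂) ∧
    (Normalized R → upN R (X₁ ∪ X₂) = Y₁ ∪ Y₂ ∧ downN R (Y₁ ∪ Y₂) = X₁ ∪ X₂) := by
  obtain ⟨u₁, d₁⟩ := h1
  obtain ⟨u₂, d₂⟩ := h2
  refine ⟨⟨?_, ?_⟩, fun hR => ⟨?_, ?_⟩⟩
  · rw [upN_inter, u₁, u₂]
  · rw [downN_inter, d₁, d₂]
  · exact upN_union_eq hR.1 u₁ d₁ u₂ d₂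
  · exact upN_union_eq (R := fun b a => R a b) hR.2.2.1 d₁ u₁ d₂ u₂
end

section
/- Let (A, B, R) be a formal context and (X, Y) ∈ C_N with X ≠ ∅ and X ≠ B. Then ⟨X, X^{↑π}⟩ is a property-oriented concept, that is, (X^{↑π})^{↓N} = X. -/
/-- Possibility operator sending a set of objects to a set of attributes:
`X^{↑π} = {a | ∃ b ∈ X, (a,b) ∈ R}`. -/
def upPi {α β : Type*} (R : α → β → Prop) (X : Set β) : Set α :=
  {a | ∃ b ∈ X, R a b}

/-- If `(X, Y) ∈ C_N` with `X ≠ ∅` and `X ≠ B`, then `⟨X, X^{↑π}⟩` is a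
property-oriented concept, i.e. `(X^{↑π})^{↓N} = X`. -/
theorem propertyOriented_concept {α β : Type*} (R : α → β → Prop)
    (X : Set β) (Y : Set α) (h1 : upN R X = Y) (h2 : downN R Y = X)
    (hne : X ≠ ∅) (hnB : X ≠ Set.univ) :
    downN R (upPi R X) = X := by
  refine Set.Subset.antisymm (fun b hb => ?_) fun b hb a hab => ⟨b, hb, hab⟩
  rw [← h2]
  intro a hab
  obtain ⟨b', hb', hab'⟩ := hb a hab
  rw [← h2] at hb'
  exact hb' a hab'
end

section
/- Let (A, B, R) be a normalized formal context and (X, Y) ∈ C_N. If X^↑ ≠ ∅, then ⟨X, X^↑⟩ is a formal concept, that is, (X^↑)^↓ = X. -/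
/-- Derivation operator `X^↑ = {a | (a,b) ∈ R for all b ∈ X}`. -/
def up {α β : Type*} (R : α → β → Prop) (X : Set β) : Set α :=
  {a | ∀ b ∈ X, R a b}

/-- Derivation operator `Y^↓ = {b | (a,b) ∈ R for all a ∈ Y}`. -/
def down {α β : Type*} (R : α → β → Prop) (Y : Set α) : Set β :=
  {b | ∀ a ∈ Y, R a b}

/-- In a normalized context, if `(X, Y) ∈ C_N` and `X^↑ ≠ ∅`, then `⟨X, X^↑⟩` is a
formal concept, i.e. `(X^↑)^↓ = X`. -/
theorem formal_concept_of_CN {α β : Type*} (R : α → β → Prop) (hN : Normalized R)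
    (X : Set β) (Y : Set α) (h1 : upN R X = Y) (h2 : downN R Y = X)
    (hup : up R X ≠ ∅) :
    down R (up R X) = X := by
  refine Set.Subset.antisymm (fun b hb => ?_) (fun b hb a ha => ha b hb)
  rcases X.eq_empty_or_nonempty with rfl | ⟨x, hx⟩
  · obtain ⟨a, ha⟩ := hN.2.2.2 b
    exact absurd (hb a fun _ h => h.elim) ha
  · obtain ⟨a, ha⟩ := Set.nonempty_iff_ne_empty.mpr hup
    have haY : a ∈ Y := (h2.symm ▸ hx : x ∈ downN R Y) a (ha x hx)
    exact (h1.symm ▸ haY : a ∈ upN R X) b (hb a ha)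
end

section
/- Let (A, B, R) be a normalized formal context and (X, Y) ∈ C_N. If Y^↓ ≠ ∅, then ⟨Y^↓, Y⟩ is a formal concept, that is, (Y^↓)^↑ = Y. -/
/-- In a normalized context, if `(X, Y) ∈ C_N` and `Y^↓ ≠ ∅`, then `⟨Y^↓, Y⟩` is a
formal concept, i.e. `(Y^↓)^↑ = Y`. -/
theorem formal_concept_of_CN_dual {α β : Type*} (R : α → β → Prop) (hN : Normalized R)
    (X : Set β) (Y : Set α) (h1 : upN R X = Y) (h2 : downN R Y = X)
    (hdown : down R Y ≠ ∅) :
    up R (down R Y) = Y := by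
  subst h2
  refine Set.Subset.antisymm (fun a ha => ?_) fun a ha b hb => hb a ha
  rcases Y.eq_empty_or_nonempty with rfl | ⟨y, hy⟩
  · obtain ⟨b, hb⟩ := hN.2.1 a
    exact absurd (ha b fun _ h => h.elim) hb
  · obtain ⟨b, hb⟩ := Set.nonempty_iff_ne_empty.mpr hdown
    have hbX : b ∈ downN R Y := (h1.symm ▸ hy : y ∈ upN R (downN R Y)) b (hb y hy)
    exact hbX a (ha b hb)
end

section
/- Let (A, B, R) be a formal context and (X, Y) ∈ C_N with X ≠ ∅ and X ≠ B. If X^↑ ≠ ∅, then ⟨X, X^↑⟩ is a coatom of the concept lattice: there exists no formal concept ⟨X₀, Y₀⟩ (i.e. X₀ ⊆ B, Y₀ ⊆ A with X₀^↑ = Y₀ and Y₀^↓ = X₀) such that X ⊊ X₀ ⊊ B. -/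
/-- If `(X, Y) ∈ C_N` with `X ≠ ∅`, `X ≠ B` and `X^↑ ≠ ∅`, then `⟨X, X^↑⟩` is a
coatom of the concept lattice: no formal concept lies strictly between `X` and `B`. -/
theorem coatom_of_CN {α β : Type*} (R : α → β → Prop)
    (X : Set β) (Y : Set α) (h1 : upN R X = Y) (h2 : downN R Y = X)
    (hne : X ≠ ∅) (hnB : X ≠ Set.univ) (hup : up R X ≠ ∅) :
    ¬ ∃ (X₀ : Set β) (Y₀ : Set α), up R X₀ = Y₀ ∧ down R Y₀ = X₀ ∧
      X ⊂ X₀ ∧ X₀ ⊂ Set.univ := by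
  rintro ⟨X₀, Y₀, hY₀, hX₀, hlt, hlt_univ⟩
  obtain ⟨x, hx⟩ := Set.nonempty_iff_ne_empty.mpr hne
  obtain ⟨b, hb, hbX⟩ := Set.exists_of_ssubset hlt
  refine hlt_univ.ne (Set.eq_univ_of_forall fun c => ?_)
  rw [← hX₀]
  intro a ha
  rw [← hY₀] at ha
  have haY : a ∈ upN R X := by
    rw [h1]
    rw [← h2] at hx
    exact hx a (ha x (hlt.subset (h2 ▸ hx)))
  exact absurd (haY b (ha b hb)) hbX
end

section
/- Let (A, B, R) be a normalized formal context and (X, Y) ∈ C_N with X ≠ ∅ and X ≠ B. If X^↑ ≠ ∅ and Y^↓ ≠ ∅, then Y^↓ ⊆ X, that is, the concept ⟨Y^↓, Y⟩ is below the concept generated by ⟨X, X^↑⟩. -/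
/-- In a normalized context, if `(X, Y) ∈ C_N` with `X ≠ ∅`, `X ≠ B`, `X^↑ ≠ ∅` and
`Y^↓ ≠ ∅`, then `Y^↓ ⊆ X`. -/
theorem extent_subset_of_CN {α β : Type*} (R : α → β → Prop) (hN : Normalized R)
    (X : Set β) (Y : Set α) (h1 : upN R X = Y) (h2 : downN R Y = X)
    (hne : X ≠ ∅) (hnB : X ≠ Set.univ)
    (hup : up R X ≠ ∅) (hdown : down R Y ≠ ∅) :
    down R Y ⊆ X := by
  intro b hb
  obtain ⟨x, hx⟩ := Set.nonempty_iff_ne_empty.mpr hne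
  obtain ⟨a, hax⟩ := hN.2.2.1 x
  have haY : a ∈ Y := (h2.symm ▸ hx : x ∈ downN R Y) a hax
  exact (h1.symm ▸ haY : a ∈ upN R X) b (hb a haY)
end

section
/- Let L be a complete lattice with an adjoint triple (&, ↙, ↖), let R : A × B → L be a fuzzy context, and let (g_i, f_i)_{i ∈ I} be a family of pairs in F_N. Then the pointwise infimum pair (⨅_{i ∈ I} g_i, ⨅_{i ∈ I} f_i) also belongs to F_N, i.e. (⨅_{i ∈ I} g_i)^{↑N} = ⨅_{i ∈ I} f_i and (⨅_{i ∈ I} f_i)^{↓N} = ⨅_{i ∈ I} g_i; consequently F_N, with the pointwise order, is a complete lattice. -/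
/-- Fuzzy necessity operator `g^{↑N}(a) = ⨅_{b} (g b ↙ R a b)`. -/
def fupN {L A B : Type*} [CompleteLattice L] (limp : L → L → L)
    (R : A → B → L) (g : B → L) : A → L :=
  fun a => ⨅ b, limp (g b) (R a b)

/-- Fuzzy necessity operator `f^{↓N}(b) = ⨅_{a} (f a ↖ R a b)`. -/
def fdownN {L A B : Type*} [CompleteLattice L] (rimp : L → L → L)
    (R : A → B → L) (f : A → L) : B → L :=
  fun b => ⨅ a, rimp (f a) (R a b)

/-- Fuzzy possibility operator `g^{↑π}(a) = ⨆_{b} (R a b & g b)`. -/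
def fupPi {L A B : Type*} [CompleteLattice L] (conj : L → L → L)
    (R : A → B → L) (g : B → L) : A → L :=
  fun a => ⨆ b, conj (R a b) (g b)

/-- The adjoint property of an adjoint triple `(&, ↙, ↖)`:
`x ≤ z ↙ y ↔ x & y ≤ z ↔ y ≤ z ↖ x`. -/
def AdjointTriple {L : Type*} [CompleteLattice L] (conj limp rimp : L → L → L) : Prop :=
  ∀ x y z : L, (x ≤ limp z y ↔ conj x y ≤ z) ∧ (conj x y ≤ z ↔ y ≤ rimp z x)

theorem AdjointTriple.limp_iInf {L ι : Type*} [CompleteLattice L] {conj limp rimp : L → L → L}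
    (adj : AdjointTriple conj limp rimp) (z : ι → L) (y : L) :
    limp (⨅ i, z i) y = ⨅ i, limp (z i) y :=
  eq_of_forall_le_iff fun x => by simp only [le_iInf_iff, (adj x y _).1]

theorem AdjointTriple.rimp_iInf {L ι : Type*} [CompleteLattice L] {conj limp rimp : L → L → L}
    (adj : AdjointTriple conj limp rimp) (z : ι → L) (x : L) :
    rimp (⨅ i, z i) x = ⨅ i, rimp (z i) x :=
  eq_of_forall_le_iff fun y => by simp only [le_iInf_iff, ← (adj x y _).2]

theorem fupN_iInf {L A B ι : Type*} [CompleteLattice L] {conj limp rimp : L → L → L}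
    (adj : AdjointTriple conj limp rimp) (R : A → B → L) (g : ι → B → L) :
    fupN limp R (⨅ i, g i) = ⨅ i, fupN limp R (g i) := by
  funext a
  simp only [fupN, iInf_apply, adj.limp_iInf]
  exact iInf_comm

theorem fdownN_iInf {L A B ι : Type*} [CompleteLattice L] {conj limp rimp : L → L → L}
    (adj : AdjointTriple conj limp rimp) (R : A → B → L) (f : ι → A → L) :
    fdownN rimp R (⨅ i, f i) = ⨅ i, fdownN rimp R (f i) := by
  funext b
  simp only [fdownN, iInf_apply, adj.rimp_iInf]
  exact iInf_comm

/-- The pointwise infimum of a family of pairs in `F_N` is again in `F_N`, and it is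
the greatest lower bound of the family; consequently `F_N` with the pointwise order
is a complete lattice. -/
theorem iInf_pair_mem_FN {L A B ι : Type*} [CompleteLattice L]
    (conj limp rimp : L → L → L) (adj : AdjointTriple conj limp rimp)
    (R : A → B → L) (g : ι → B → L) (f : ι → A → L)
    (hFN : ∀ i, fupN limp R (g i) = f i ∧ fdownN rimp R (f i) = g i) :
    fupN limp R (⨅ i, g i) = (⨅ i, f i) ∧
    fdownN rimp R (⨅ i, f i) = (⨅ i, g i) ∧
    IsGLB {p : (B → L) × (A → L) | ∃ i, p = (g i, f i)} (⨅ i, g i, ⨅ i, f i) := by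
  refine ⟨?_, ?_, ?_, fun p hp => ⟨?_, ?_⟩⟩
  · simp only [fupN_iInf adj, (hFN _).1]
  · simp only [fdownN_iInf adj, (hFN _).2]
  · rintro _ ⟨i, rfl⟩
    exact ⟨iInf_le g i, iInf_le f i⟩
  · exact le_iInf fun i => (hp ⟨i, rfl⟩).1
  · exact le_iInf fun i => (hp ⟨i, rfl⟩).2
end

section
/- Let L be a complete lattice with an adjoint triple (&, ↙, ↖), let R : A × B → L be a fuzzy context, and let (g, f) ∈ F_N. Then g^{↑π}(a) ≤ g^{↑N}(a) for every a ∈ A. -/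
/-- For a pair `(g, f) ∈ F_N`, the possibility image of `g` is below its necessity
image: `g^{↑π}(a) ≤ g^{↑N}(a)` for every attribute `a`. -/
theorem fupPi_le_fupN {L A B : Type*} [CompleteLattice L]
    (conj limp rimp : L → L → L) (adj : AdjointTriple conj limp rimp)
    (R : A → B → L) (g : B → L) (f : A → L)
    (h1 : fupN limp R g = f) (h2 : fdownN rimp R f = g) :
    ∀ a : A, fupPi conj R g a ≤ fupN limp R g a := by
  subst h1
  exact fun a => iSup_le fun b =>
    (adj _ _ _).2.2 ((congrFun h2 b).symm.le.trans (iInf_le _ a))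
end

section
/- Let L be a complete lattice with an adjoint triple (&, ↙, ↖), let R : A × B → L be a fuzzy context, and let (g, f) ∈ F_N. Then (g^{↑π})^{↓N} = g, so the pair ⟨g, g^{↑π}⟩ is a property-oriented concept. -/
/-- For a pair `(g, f) ∈ F_N`, the pair `⟨g, g^{↑π}⟩` is a property-oriented concept,
i.e. `(g^{↑π})^{↓N} = g`. -/
theorem propertyOriented_concept_FN {L A B : Type*} [CompleteLattice L]
    (conj limp rimp : L → L → L) (adj : AdjointTriple conj limp rimp)
    (R : A → B → L) (g : B → L) (f : A → L)
    (h1 : fupN limp R g = f) (h2 : fdownN rimp R f = g) :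
    fdownN rimp R (fupPi conj R g) = g := by
  have pi_le : ∀ a, fupPi conj R g a ≤ f a := fun a => iSup_le fun b =>
    (adj _ _ _).2.2 ((congrFun h2 b).ge.trans (iInf_le _ a))
  funext b
  apply le_antisymm
  · refine le_trans (le_iInf fun a => ?_) (congrFun h2 b).le
    exact (adj _ _ _).2.1 (((adj _ _ _).2.2 (iInf_le _ a)).trans (pi_le a))
  · exact le_iInf fun a => (adj _ _ _).2.1 (le_iSup (fun b => conj (R a b) (g b)) b)
end

section
/- Let R : A × B → [0,1] be a fuzzy context over the Gödel frame that is ⊤-normalized by rows, and let (g, f) ∈ F_N. Then g^{↑N}(a) ≤ g^{↑π}(a) for every a ∈ A. -/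
open unitInterval

instance : Fact ((0:ℝ) ≤ 1) := ⟨zero_le_one⟩

/-- The Gödel implication on the unit interval: `z ← y = 1` if `y ≤ z`, and `z`
otherwise. -/
noncomputable def gImp (z y : unitInterval) : unitInterval :=
  if y ≤ z then 1 else z

/-- Gödel necessity operator `g^{↑N}(a) = ⨅_{b} (g b ← R a b)`. -/
noncomputable def gUpN {A B : Type*} (R : A → B → unitInterval)
    (g : B → unitInterval) : A → unitInterval :=
  fun a => ⨅ b, gImp (g b) (R a b)

/-- Gödel necessity operator `f^{↓N}(b) = ⨅_{a} (f a ← R a b)`. -/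
noncomputable def gDownN {A B : Type*} (R : A → B → unitInterval)
    (f : A → unitInterval) : B → unitInterval :=
  fun b => ⨅ a, gImp (f a) (R a b)

/-- Gödel possibility operator `g^{↑π}(a) = ⨆_{b} min (R a b) (g b)`. -/
noncomputable def gUpPi {A B : Type*} (R : A → B → unitInterval)
    (g : B → unitInterval) : A → unitInterval :=
  fun a => ⨆ b, R a b ⊓ g b

/-- Gödel derivation operator `g^↑(a) = ⨅_{b} (R a b ← g b)`. -/
noncomputable def gUp {A B : Type*} (R : A → B → unitInterval)
    (g : B → unitInterval) : A → unitInterval :=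
  fun a => ⨅ b, gImp (R a b) (g b)

/-- Gödel derivation operator `f^↓(b) = ⨅_{a} (R a b ← f a)`. -/
noncomputable def gDown {A B : Type*} (R : A → B → unitInterval)
    (f : A → unitInterval) : B → unitInterval :=
  fun b => ⨅ a, gImp (R a b) (f a)

/-- A fuzzy context is `⊤`-normalized by rows if every attribute attains the value `1`
at some object. -/
def TopNormalizedRows {A B : Type*} (R : A → B → unitInterval) : Prop :=
  ∀ a, ∃ b, R a b = 1

theorem gImp_one_right (z : unitInterval) : gImp z 1 = z := by
  unfold gImp
  split_ifs with h
  · exact le_antisymm h unitInterval.le_one'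
  · rfl

/-- Over the Gödel frame, for a `⊤`-normalized (by rows) context and `(g, f) ∈ F_N`,
the necessity image of `g` is below its possibility image. -/
theorem gUpN_le_gUpPi {A B : Type*} (R : A → B → unitInterval)
    (hTN : TopNormalizedRows R) (g : B → unitInterval) (f : A → unitInterval)
    (h1 : gUpN R g = f) (h2 : gDownN R f = g) :
    ∀ a : A, gUpN R g a ≤ gUpPi R g a := by
  intro a
  obtain ⟨b, hb⟩ := hTN a
  calc gUpN R g a ≤ gImp (g b) (R a b) := iInf_le (fun b => gImp (g b) (R a b)) b
    _ = R a b ⊓ g b := by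
      rw [hb, gImp_one_right, inf_eq_right.mpr unitInterval.le_one']
    _ ≤ gUpPi R g a := le_iSup (fun b => R a b ⊓ g b) b
end

section
/- Let R : A × B → [0,1] be a fuzzy context over the Gödel frame that is ⊤-normalized by rows, and let (g, f) ∈ F_N be such that for every a ∈ A there exists b ∈ B with g(b) ≰ R(a,b) (i.e. R(a,b) < g(b)). Then g^↑(a) ≤ g^{↑π}(a) for every a ∈ A. -/
open unitInterval

/-- Over the Gödel frame, for a `⊤`-normalized (by rows) context and `(g, f) ∈ F_N`
such that for every attribute `a` there is an object `b` with `g b ≰ R a b`, the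
derivation image of `g` is below its possibility image. -/
theorem gUp_le_gUpPi {A B : Type*} (R : A → B → unitInterval)
    (hTN : TopNormalizedRows R) (g : B → unitInterval) (f : A → unitInterval)
    (h1 : gUpN R g = f) (h2 : gDownN R f = g)
    (hg : ∀ a : A, ∃ b : B, ¬ g b ≤ R a b) :
    ∀ a : A, gUp R g a ≤ gUpPi R g a := by
  intro a
  obtain ⟨b, hb⟩ := hg a
  calc gUp R g a ≤ gImp (R a b) (g b) := iInf_le (fun b => gImp (R a b) (g b)) b
    _ = R a b ⊓ g b := by rw [gImp, if_neg hb, inf_eq_left.mpr (not_le.mp hb).le]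
    _ ≤ gUpPi R g a := le_iSup (fun b => R a b ⊓ g b) b
end

section
/- Let R : A × B → [0,1] be a fuzzy context over the Gödel frame that is ⊤-normalized by rows, and let (g, f) ∈ F_N be such that for every a ∈ A there exists b ∈ B with g(b) ≰ R(a,b) (i.e. R(a,b) < g(b)). Then f^↓(b) ≤ (g^↑)^↓(b) for every b ∈ B, that is, the concept ⟨f^↓, (f^↓)^↑⟩ is below the concept ⟨(g^↑)^↓, g^↑⟩. -/
open unitInterval

theorem gUp_le_of_gDownN_eq {A B : Type*} {R : A → B → unitInterval}
    {g : B → unitInterval} {f : A → unitInterval} (h : gDownN R f = g)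
    (hg : ∀ a : A, ∃ b : B, ¬ g b ≤ R a b) (a : A) : gUp R g a ≤ f a := by
  obtain ⟨b, hb⟩ := hg a
  have hR : gUp R g a ≤ R a b := (iInf_le _ b).trans_eq (if_neg hb)
  refine hR.trans (le_of_not_gt fun hlt => hb ?_)
  have hgf : g b ≤ f a := by
    rw [← h]
    exact (iInf_le _ a).trans_eq (if_neg hlt.not_ge)
  exact hgf.trans hlt.le

theorem gImp_antitone (z : unitInterval) : Antitone (gImp z) := by
  intro x y hxy
  unfold gImp
  split_ifs with hy hx hx
  · exact le_rfl
  · exact absurd (hxy.trans hy) hx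
  · exact unitInterval.le_one'
  · exact le_rfl

/-- Over the Gödel frame, for a `⊤`-normalized (by rows) context and `(g, f) ∈ F_N`
such that for every attribute `a` there is an object `b` with `g b ≰ R a b`, one has
`f^↓ ≤ (g^↑)^↓`, i.e. the concept `⟨f^↓, (f^↓)^↑⟩` is below `⟨(g^↑)^↓, g^↑⟩`. -/
theorem gDown_f_le_gDown_gUp {A B : Type*} (R : A → B → unitInterval)
    (hTN : TopNormalizedRows R) (g : B → unitInterval) (f : A → unitInterval)
    (h1 : gUpN R g = f) (h2 : gDownN R f = g)
    (hg : ∀ a : A, ∃ b : B, ¬ g b ≤ R a b) :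
    ∀ b : B, gDown R f b ≤ gDown R (gUp R g) b := by
  exact fun b => iInf_mono fun a =>
    gImp_antitone (R a b) (gUp_le_of_gDownN_eq h2 hg a)
end
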